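/- arXiv:1112.0404 — 7 statements merged into one kernel-verified Lean document; each statement's English description precedes it below -/
import Mathlib

section
/- Let n ≥ 2. For any vector q : Fin n → ℝ with q_k > 0 for every k, there exists a unique vector x : Fin n → ℝ with x_j > 0 for every j such that ∏_{j ≠ k} x_j = q_k for every k. (This is Lemma 1 of the paper: for any positive vector q there is a unique weighted Hamiltonian cycle n → (n−1) → ⋯ → 1 → n whose vector of total weights of spanning out-trees rooted at the respective vertices equals q; the weight of the arc entering vertex k is q_k^{-1}·(∏_i q_i)^{1/(n-1)}.) -/
/-- The product of all the products that omit one factor. -/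
theorem prod_pow_card_sub_one_of_prod_erase {n : ℕ} (hn : 1 ≤ n) {x q : Fin n → ℝ}
    (hx : ∀ j, 0 < x j) (h : ∀ k, ∏ j ∈ Finset.univ.erase k, x j = q k) :
    (∏ j, x j) ^ (n - 1) = ∏ k, q k := by
  have hX : 0 < ∏ j, x j := Finset.prod_pos fun j _ => hx j
  have hmul : (∏ k, q k) * ∏ k, x k = (∏ j, x j) ^ n := by
    simp [← Finset.prod_mul_distrib, ← h, Finset.prod_erase_mul]
  refine mul_right_cancel₀ hX.ne' ?_
  rw [hmul, ← pow_succ, Nat.sub_add_cancel hn]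

/-- Lemma 1 of the paper: For `n ≥ 2` and any positive vector `q : Fin n → ℝ`,
there exists a unique positive vector `x : Fin n → ℝ` such that `∏_{j ≠ k} x_j = q_k` for
every `k`, i.e., a unique weighted Hamiltonian cycle whose vector of total weights of
spanning out-trees equals `q`. -/
theorem exists_unique_cycle_weights (n : ℕ) (hn : 2 ≤ n) (q : Fin n → ℝ)
    (hq : ∀ k, 0 < q k) :
    ∃! x : Fin n → ℝ, (∀ j, 0 < x j) ∧
      (∀ k, ∏ j ∈ Finset.univ.erase k, x j = q k) := by
  have hn1 : n - 1 ≠ 0 := by omega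
  have hQ : 0 < ∏ k, q k := Finset.prod_pos fun k _ => hq k
  obtain ⟨P, hP, hPQ⟩ : ∃ P : ℝ, 0 < P ∧ P ^ (n - 1) = ∏ k, q k :=
    ⟨(∏ k, q k) ^ ((n - 1 : ℕ) : ℝ)⁻¹, Real.rpow_pos_of_pos hQ _,
      Real.rpow_inv_natCast_pow hQ.le hn1⟩
  have hprod : ∏ k, P / q k = P := by
    rw [Finset.prod_div_distrib, Finset.prod_const, Finset.card_univ, Fintype.card_fin,
      div_eq_iff hQ.ne', ← hPQ, ← pow_succ', Nat.sub_add_cancel (by omega)]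
  refine ⟨fun k => P / q k, ⟨fun k => div_pos hP (hq k), fun k => ?_⟩, ?_⟩
  · refine mul_right_cancel₀ (div_pos hP (hq k)).ne' ?_
    rw [Finset.prod_erase_mul _ (fun k => P / q k) (Finset.mem_univ k), hprod,
      mul_div_cancel₀ _ (hq k).ne']
  · rintro y ⟨hy, hyq⟩
    have hyP : ∏ j, y j = P := by
      refine (pow_left_inj₀ (Finset.prod_pos fun j _ => hy j).le hP.le hn1).1 ?_
      rw [prod_pow_card_sub_one_of_prod_erase (by omega) hy hyq, hPQ]
    funext k
    rw [eq_div_iff (hq k).ne', ← hyP, ← hyq k, Finset.mul_prod_erase _ _ (Finset.mem_univ k)]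
end

section
/- Let n ≥ 2, let π : Fin n → ℝ be a positive probability vector (π_k > 0 for all k and ∑_k π_k = 1), and let β be a real number with 0 < β ≤ min_k π_k. Define the n × n real matrix P by P_{k, k+1} = β/π_k (indices mod n), P_{k,k} = 1 − β/π_k, and P_{k,j} = 0 for all other entries j. Then P is row-stochastic (all entries are nonnegative and each row sums to 1) and π is a stationary vector of P, i.e., ∑_i π_i P_{i,j} = π_j for every j. -/
/-- Let `π` be a positive probability vector on `Fin n` (`n ≥ 2`) and
`0 < β ≤ min_k π_k`. The matrix `P` of the Hamiltonian cycle with loops, where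
`P k (k+1) = β/π_k` (indices mod `n`), `P k k = 1 - β/π_k` and all other entries `0`,
is row-stochastic and `π` is a stationary vector of `P`. -/
theorem cycle_with_loops_stochastic_and_stationary (n : ℕ) (hn : 2 ≤ n)
    (π : Fin n → ℝ) (hπpos : ∀ k, 0 < π k) (hπsum : ∑ k, π k = 1)
    (β : ℝ) (hβpos : 0 < β) (hβle : ∀ k, β ≤ π k)
    (P : Matrix (Fin n) (Fin n) ℝ)
    (hP : ∀ k j, P k j =
      if (j : ℕ) = ((k : ℕ) + 1) % n then β / π k else if j = k then 1 - β / π k else 0) :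
    (∀ i j, 0 ≤ P i j) ∧ (∀ i, ∑ j, P i j = 1) ∧ (∀ j, ∑ i, π i * P i j = π j) := by
  obtain ⟨m, rfl⟩ := Nat.exists_eq_add_of_le' hn
  have hP' (k j : Fin (m + 2)) :
      P k j = (if j = k + 1 then β / π k else 0) + (if j = k then 1 - β / π k else 0) := by
    have hsucc : (j : ℕ) = ((k : ℕ) + 1) % (m + 2) ↔ j = k + 1 := by
      simp [Fin.ext_iff, Fin.val_add]
    have hne : k + 1 ≠ k := by simp
    rw [hP]
    simp only [hsucc]
    by_cases h : j = k + 1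
    · simp [h, hne]
    · simp [h]
  refine ⟨fun i j => ?_, fun i => ?_, fun j => ?_⟩
  · have hdiv : β / π i ≤ 1 := (div_le_one (hπpos i)).2 (hβle i)
    have hpos : 0 < β / π i := div_pos hβpos (hπpos i)
    rw [hP]
    split_ifs <;> linarith
  · simp [hP', Finset.sum_add_distrib]
  · have hflow (i : Fin (m + 2)) : π i * P i j =
        (if i = j - 1 then β else 0) + (if i = j then π i - β else 0) := by
      have hi : π i ≠ 0 := (hπpos i).ne'
      rw [hP', mul_add, mul_ite, mul_ite, mul_zero, mul_sub, mul_one, mul_div_cancel₀ _ hi]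
      simp only [eq_sub_iff_add_eq, eq_comm]
    simp [hflow, Finset.sum_add_distrib]
end

section
/- Let n ≥ 2 and let x : Fin n → ℝ satisfy 0 < x_k ≤ 1 for every k. Define the n × n real matrix P by P_{k, k+1} = x_k (indices mod n), P_{k,k} = 1 − x_k, and all other entries 0, and define π : Fin n → ℝ by π_k = x_k^{-1} / (∑_j x_j^{-1}). Then P is row-stochastic, π is a probability vector, and π is the unique stationary probability vector of P; i.e., πᵀP = πᵀ, and any probability vector μ with μᵀP = μᵀ equals π. (Interpretation: in DeGroot's procedure on a Hamiltonian cycle with loops, the final weight of agent k is inversely proportional to the weight x_k of the arc entering vertex k.) -/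
/-- The entries of the matrix of a cycle with loops, as a sum of the arc part and the loop part. -/
theorem cycle_with_loops_entry {m : ℕ} (x : Fin (m + 2) → ℝ) (k j : Fin (m + 2)) :
    (if (j : ℕ) = ((k : ℕ) + 1) % (m + 2) then x k else if j = k then 1 - x k else 0) =
      (if j = k + 1 then x k else 0) + (if j = k then 1 - x k else 0) := by
  have hval : (j : ℕ) = ((k : ℕ) + 1) % (m + 2) ↔ j = k + 1 := by
    rw [Fin.ext_iff, Fin.val_add, Fin.val_one]
  have hne : k + 1 ≠ k := by simp
  simp only [hval]
  split_ifs with h₁ h₂ <;> simp_all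

/-- The product of a row vector with the matrix of a cycle with loops. -/
theorem sum_mul_cycle_with_loops {m : ℕ} (x v : Fin (m + 2) → ℝ) (j : Fin (m + 2)) :
    ∑ i, v i * ((if j = i + 1 then x i else 0) + (if j = i then 1 - x i else 0)) =
      v (j - 1) * x (j - 1) + v j * (1 - x j) := by
  have harc (i : Fin (m + 2)) : j = i + 1 ↔ j - 1 = i := sub_eq_iff_eq_add.symm
  simp only [harc, mul_add, mul_ite, mul_zero, Finset.sum_add_distrib, Finset.sum_ite_eq,
    Finset.mem_univ, if_true]

/-- A function on the cycle that is invariant under the shift is constant. -/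
theorem Fin.eq_zero_of_sub_one_invariant {α : Type*} {m : ℕ} {f : Fin (m + 2) → α}
    (hf : ∀ j, f (j - 1) = f j) (k : Fin (m + 2)) : f k = f 0 := by
  induction k using Fin.induction with
  | zero => rfl
  | succ i ih =>
    rw [← hf, ← ih, ← Fin.coeSucc_eq_succ, add_sub_cancel_right]


/-- Let `0 < x_k ≤ 1` for all `k` (`n ≥ 2`), let `P` be the matrix of the
Hamiltonian cycle with loops with `P k (k+1) = x_k`, `P k k = 1 - x_k`, other entries `0`,
and let `π_k = x_k⁻¹ / ∑_j x_j⁻¹`. Then `P` is row-stochastic, `π` is a probability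
vector, `πᵀP = πᵀ`, and `π` is the unique stationary probability vector of `P`. -/
theorem cycle_with_loops_unique_stationary (n : ℕ) (hn : 2 ≤ n)
    (x : Fin n → ℝ) (hx0 : ∀ k, 0 < x k) (hx1 : ∀ k, x k ≤ 1)
    (P : Matrix (Fin n) (Fin n) ℝ)
    (hP : ∀ k j, P k j = if (j : ℕ) = ((k : ℕ) + 1) % n then x k else if j = k then 1 - x k else 0)
    (π : Fin n → ℝ) (hπ : ∀ k, π k = (x k)⁻¹ / ∑ j, (x j)⁻¹) :
    (∀ i j, 0 ≤ P i j) ∧ (∀ i, ∑ j, P i j = 1) ∧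
    (∀ k, 0 ≤ π k) ∧ (∑ k, π k = 1) ∧
    (∀ j, ∑ i, π i * P i j = π j) ∧
    (∀ μ : Fin n → ℝ, (∀ k, 0 ≤ μ k) → (∑ k, μ k = 1) →
      (∀ j, ∑ i, μ i * P i j = μ j) → μ = π) := by
  obtain ⟨m, rfl⟩ : ∃ m, n = m + 2 := ⟨n - 2, by omega⟩
  have hP' (k j : Fin (m + 2)) :
      P k j = (if j = k + 1 then x k else 0) + (if j = k then 1 - x k else 0) :=
    (hP k j).trans (cycle_with_loops_entry x k j)
  have hsum : 0 < ∑ j, (x j)⁻¹ :=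
    Finset.sum_pos (fun k _ => inv_pos.2 (hx0 k)) Finset.univ_nonempty
  have hxπ (k : Fin (m + 2)) : π k * x k = (∑ j, (x j)⁻¹)⁻¹ := by
    have := (hx0 k).ne'
    rw [hπ]
    field_simp
  refine ⟨fun i j => ?_, fun i => ?_, fun k => ?_, ?_, fun j => ?_, fun μ _ hμ1 hμ => ?_⟩
  · have h0 := hx0 i
    have h1 := hx1 i
    rw [hP']
    split_ifs <;> linarith
  · simp [hP', Finset.sum_add_distrib]
  · rw [hπ]
    exact div_nonneg (inv_nonneg.2 (hx0 k).le) hsum.le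
  · simp only [hπ]
    rw [← Finset.sum_div, div_self hsum.ne']
  · simp only [hP']
    rw [sum_mul_cycle_with_loops, hxπ, ← hxπ j]
    ring
  · have hstep (j : Fin (m + 2)) : μ (j - 1) * x (j - 1) = μ j * x j := by
      have h := hμ j
      simp only [hP'] at h
      rw [sum_mul_cycle_with_loops] at h
      linarith
    have hμx (k : Fin (m + 2)) : μ k = μ 0 * x 0 * (x k)⁻¹ :=
      (eq_mul_inv_iff_mul_eq₀ (hx0 k).ne').2
        (Fin.eq_zero_of_sub_one_invariant (f := fun k => μ k * x k) hstep k)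
    have hc : μ 0 * x 0 * ∑ j, (x j)⁻¹ = 1 := by
      rw [Finset.mul_sum, ← hμ1]
      exact Finset.sum_congr rfl fun k _ => (hμx k).symm
    funext k
    rw [hμx, hπ, eq_div_iff hsum.ne', mul_right_comm, hc, one_mul]
end

section
/- Let n ≥ 2 and let x : Fin n → ℝ satisfy 0 < x_k < 1 for every k. Define the n × n real matrix P by P_{k, k+1} = x_k (indices mod n), P_{k,k} = 1 − x_k, and all other entries 0, and define π : Fin n → ℝ by π_k = x_k^{-1} / (∑_j x_j^{-1}). Then the sequence of matrix powers P^m converges (entrywise) as m → ∞ to the rank-one matrix 𝟙πᵀ, i.e., to the matrix whose (i,j) entry is π_j for all i, j. -/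
open scoped Matrix.Norms.Operator in
/-- The `L^∞` operator norm of a nonnegative matrix is bounded by any bound on its row sums. -/
theorem Matrix.linfty_opNorm_le_of_sum_row_le {ι κ : Type*} [Fintype ι] [Fintype κ]
    {A : Matrix ι κ ℝ} {c : ℝ} (hc : 0 ≤ c) (hA : ∀ i j, 0 ≤ A i j)
    (hsum : ∀ i, ∑ j, A i j ≤ c) : ‖A‖ ≤ c := by
  lift c to NNReal using hc
  rw [Matrix.linfty_opNorm_def, NNReal.coe_le_coe]
  refine Finset.sup_le fun i _ => ?_
  rw [← NNReal.coe_le_coe, NNReal.coe_sum]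
  simpa [Real.norm_of_nonneg (hA i _)] using hsum i

/-- If `E` is an idempotent absorbed by `Q` on both sides, then perturbing `Q` by a multiple of `E`
does not change its powers away from the range of `E`. -/
theorem sub_smul_pow_mul_one_sub {R : Type*} [Ring R] [Algebra ℝ R] {Q E : R} (δ : ℝ)
    (hQE : Q * E = E) (hEQ : E * Q = E) (hEE : E * E = E) (k : ℕ) :
    (Q - δ • E) ^ k * (1 - E) = Q ^ k - E := by
  induction k with
  | zero => simp
  | succ k ih =>
    have h : (Q - δ • E) * (1 - E) = (1 - E) * Q := by
      simp [sub_mul, mul_sub, hQE, hEQ, hEE]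
    rw [pow_succ, mul_assoc, h, ← mul_assoc, ih, sub_mul, hEQ, pow_succ]

theorem pow_mul_eq_self {M : Type*} [Monoid M] {a b : M} (h : a * b = b) (k : ℕ) :
    a ^ k * b = b := by
  induction k with
  | zero => simp
  | succ k ih => rw [pow_succ, mul_assoc, h, ih]

theorem mul_pow_eq_self {M : Type*} [Monoid M] {a b : M} (h : b * a = b) (k : ℕ) :
    b * a ^ k = b := by
  induction k with
  | zero => simp
  | succ k ih => rw [pow_succ, ← mul_assoc, ih, h]

open scoped Matrix.Norms.Operator in
/-- The powers of a primitive row-stochastic matrix with stationary distribution `π` converge to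
the matrix all of whose rows are `π`. -/
theorem Matrix.IsPrimitive.tendsto_pow_of_mem_rowStochastic {ι : Type*} [Fintype ι] [DecidableEq ι]
    {P : Matrix ι ι ℝ} (hprim : P.IsPrimitive) (hP : P ∈ Matrix.rowStochastic ℝ ι)
    {π : ι → ℝ} (hπ0 : ∀ i, 0 ≤ π i) (hπ1 : ∑ i, π i = 1) (hπP : Matrix.vecMul π P = π) :
    Filter.Tendsto (fun m : ℕ => P ^ m) Filter.atTop (nhds (Matrix.of fun _ j => π j)) := by
  rcases isEmpty_or_nonempty ι with _ | _
  · simp at hπ1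
  set E : Matrix ι ι ℝ := Matrix.of fun _ j => π j with hE
  obtain ⟨N, hN, hpos⟩ := hprim.exists_pos_pow
  set Q := P ^ N
  have hPE : P * E = E := by
    ext i j
    simp [Matrix.mul_apply, hE, ← Finset.sum_mul, Matrix.sum_row_of_mem_rowStochastic hP]
  have hEP : E * P = E := by
    ext i j
    simpa [Matrix.mul_apply, hE, Matrix.vecMul, dotProduct] using congrFun hπP j
  have hEE : E * E = E := by
    ext i j
    simp [Matrix.mul_apply, hE, ← Finset.sum_mul, hπ1]
  have hQS : Q ∈ Matrix.rowStochastic ℝ ι := pow_mem hP N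
  obtain ⟨p, hp⟩ := Finite.exists_min fun p : ι × ι => Q p.1 p.2
  set δ := Q p.1 p.2
  have hδ0 : 0 < δ := hpos _ _
  have hδ1 : δ ≤ 1 := Matrix.le_one_of_mem_rowStochastic hQS
  have hπle (j : ι) : π j ≤ 1 :=
    hπ1 ▸ Finset.single_le_sum (fun k _ => hπ0 k) (Finset.mem_univ j)
  have hnorm : ‖Q - δ • E‖ ≤ 1 - δ := by
    refine Matrix.linfty_opNorm_le_of_sum_row_le (by linarith) (fun i j => ?_) fun i => ?_
    · have h1 := hp (i, j)
      have h2 := mul_le_mul_of_nonneg_left (hπle j) hδ0.le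
      simp only [hE, Matrix.sub_apply, Matrix.smul_apply, Matrix.of_apply, smul_eq_mul]
      linarith
    · simp [hE, Finset.sum_sub_distrib, ← Finset.mul_sum, hπ1,
        Matrix.sum_row_of_mem_rowStochastic hQS]
  have hbound (m : ℕ) : ‖P ^ m - E‖ ≤ (1 - δ) ^ (m / N) * ‖1 - E‖ := by
    have hsplit : P ^ m - E = P ^ (m % N) * ((Q - δ • E) ^ (m / N) * (1 - E)) := by
      rw [sub_smul_pow_mul_one_sub δ (pow_mul_eq_self hPE N) (mul_pow_eq_self hEP N) hEE,
        mul_sub, pow_mul_eq_self hPE, ← pow_mul, ← pow_add, Nat.mod_add_div]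
    have h1 : ‖P ^ (m % N)‖ ≤ 1 :=
      Matrix.linfty_opNorm_le_of_sum_row_le zero_le_one
        (fun i j => Matrix.nonneg_of_mem_rowStochastic (pow_mem hP _))
        fun i => (Matrix.sum_row_of_mem_rowStochastic (pow_mem hP _) i).le
    calc ‖P ^ m - E‖
        ≤ ‖P ^ (m % N)‖ * (‖(Q - δ • E) ^ (m / N)‖ * ‖1 - E‖) := by
          rw [hsplit]
          exact (norm_mul_le _ _).trans
            (mul_le_mul_of_nonneg_left (norm_mul_le _ _) (norm_nonneg _))
      _ ≤ 1 * ((1 - δ) ^ (m / N) * ‖1 - E‖) := by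
          gcongr
          exact (norm_pow_le _ _).trans (pow_le_pow_left₀ (norm_nonneg _) hnorm _)
      _ = _ := one_mul _
  refine tendsto_iff_norm_sub_tendsto_zero.2 ?_
  refine squeeze_zero (fun _ => norm_nonneg _) hbound ?_
  simpa using ((tendsto_pow_atTop_nhds_zero_of_lt_one (by linarith) (by linarith)).comp
    (Nat.tendsto_div_const_atTop hN.ne')).mul_const ‖1 - E‖

/-- Let `0 < x_k < 1` for all `k` (`n ≥ 2`), let `P` be the matrix of the
Hamiltonian cycle with loops with `P k (k+1) = x_k`, `P k k = 1 - x_k`, other entries `0`,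
and let `π_k = x_k⁻¹ / ∑_j x_j⁻¹`. Then `P^m` converges entrywise to the rank-one matrix
`𝟙πᵀ`, whose `(i,j)` entry is `π_j`. -/
theorem cycle_with_loops_powers_tendsto (n : ℕ) (hn : 2 ≤ n)
    (x : Fin n → ℝ) (hx0 : ∀ k, 0 < x k) (hx1 : ∀ k, x k < 1)
    (P : Matrix (Fin n) (Fin n) ℝ)
    (hP : ∀ k j, P k j = if (j : ℕ) = ((k : ℕ) + 1) % n then x k else if j = k then 1 - x k else 0)
    (π : Fin n → ℝ) (hπ : ∀ k, π k = (x k)⁻¹ / ∑ j, (x j)⁻¹) :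
    ∀ i j, Filter.Tendsto (fun m : ℕ => (P ^ m) i j) Filter.atTop (nhds (π j)) := by
  have : NeZero n := ⟨by omega⟩
  have hne (k : Fin n) : k + 1 ≠ k := by simp [show n ≠ 1 by omega]
  have hP' (k j : Fin n) :
      P k j = (if j = k + 1 then x k else 0) + (if j = k then 1 - x k else 0) := by
    have : (j : ℕ) = ((k : ℕ) + 1) % n ↔ j = k + 1 := by
      rw [Fin.ext_iff, Fin.val_add, Fin.val_one', Nat.add_mod_mod]
    rw [hP, if_congr this rfl rfl]
    by_cases h : j = k + 1
    · simp [h, hne]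
    · simp [h]
  have hnonneg (i j : Fin n) : 0 ≤ P i j := by
    have := hx0 i
    have := hx1 i
    rw [hP']
    split_ifs <;> linarith
  have hstoch : P ∈ Matrix.rowStochastic ℝ (Fin n) := by
    refine Matrix.mem_rowStochastic_iff_sum.2 ⟨hnonneg, fun i => ?_⟩
    simp [hP', Finset.sum_add_distrib]
  have hstep (m : ℕ) (i j k : Fin n) (h1 : 0 < (P ^ m) i k) (h2 : 0 < P k j) :
      0 < (P ^ (m + 1)) i j := by
    rw [pow_succ, Matrix.mul_apply]
    exact (mul_pos h1 h2).trans_le <| Finset.single_le_sum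
      (f := fun k => (P ^ m) i k * P k j)
      (fun k _ => mul_nonneg (Matrix.nonneg_of_mem_rowStochastic (pow_mem hstoch m))
        (hnonneg k j)) (Finset.mem_univ k)
  have hreach (m : ℕ) : ∀ k ≤ m, ∀ i : Fin n, 0 < (P ^ m) i (i + Fin.ofNat n k) := by
    induction m with
    | zero =>
      intro k hk i
      obtain rfl : k = 0 := by omega
      simp
    | succ m ih =>
      intro k hk i
      rcases hk.lt_or_eq with h | rfl
      · refine hstep m i _ _ (ih k (by omega) i) ?_
        rw [hP', if_neg (hne _).symm, if_pos rfl]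
        linarith [hx1 (i + Fin.ofNat n k)]
      · refine hstep m i _ _ (ih m le_rfl i) ?_
        have h : i + Fin.ofNat n (m + 1) = i + Fin.ofNat n m + 1 := by
          ext
          simp [Fin.val_add, add_assoc]
        rw [h, hP', if_pos rfl, if_neg (hne _)]
        linarith [hx0 (i + Fin.ofNat n m)]
  have hprim : P.IsPrimitive := by
    refine ⟨hnonneg, n, by omega, fun i j => ?_⟩
    have h := hreach n (j - i : Fin n) (j - i).isLt.le i
    simpa using h
  have hS : 0 < ∑ j, (x j)⁻¹ :=
    Finset.sum_pos (fun j _ => inv_pos.2 (hx0 j)) Finset.univ_nonempty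
  have hπx (k : Fin n) : π k * x k = (∑ j, (x j)⁻¹)⁻¹ := by
    have := (hx0 k).ne'
    rw [hπ]
    field_simp
  have hstat : Matrix.vecMul π P = π := by
    ext j
    have h (k : Fin n) : j = k + 1 ↔ j - 1 = k := sub_eq_iff_eq_add.symm
    simp [Matrix.vecMul, dotProduct, hP', mul_add, Finset.sum_add_distrib, h, hπx, mul_sub]
  have hlim := hprim.tendsto_pow_of_mem_rowStochastic hstoch
    (fun i => hπ i ▸ div_nonneg (inv_pos.2 (hx0 i)).le hS.le)
    (by simp_rw [hπ, ← Finset.sum_div, div_self hS.ne']) hstat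
  intro i j
  exact tendsto_pi_nhds.1 (tendsto_pi_nhds.1 hlim i) j
end

section
/- Let n ≥ 2 and let x : Fin n → ℝ satisfy 0 < x_k < 1 for every k. Define the n × n real matrix P by P_{k, k+1} = x_k (indices mod n), P_{k,k} = 1 − x_k, and all other entries 0, and define π : Fin n → ℝ by π_k = x_k^{-1} / (∑_j x_j^{-1}). Then for every initial opinion vector s ∈ ℝ^n, the DeGroot iteration converges to the consensus π·s: lim_{m→∞} P^m s = (∑_k π_k s_k)·𝟙, where 𝟙 is the all-ones vector; in particular all n coordinates of P^m s tend to the common limit ∑_k π_k s_k. -/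
open Filter Topology in
/-- If a nonnegative sequence `E` satisfies `0 ≤ g m ≤ E m - E (m + 1)`, then `g` tends to zero. -/
theorem tendsto_zero_of_le_decrement {E g : ℕ → ℝ} (hE : ∀ m, 0 ≤ E m) (hg : ∀ m, 0 ≤ g m)
    (h : ∀ m, g m ≤ E m - E (m + 1)) : Tendsto g atTop (𝓝 0) := by
  have hanti : Antitone E := antitone_nat_of_succ_le fun m => by linarith [hg m, h m]
  have hlim := tendsto_atTop_ciInf hanti ⟨0, by rintro _ ⟨m, rfl⟩; exact hE m⟩
  have hdec : Tendsto (fun m => E m - E (m + 1)) atTop (𝓝 0) := by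
    simpa using hlim.sub (hlim.comp (tendsto_add_atTop_nat 1))
  exact squeeze_zero hg h hdec

theorem Fin.sum_comp_add_one {N : ℕ} (f : Fin (N + 1) → ℝ) : ∑ k, f (k + 1) = ∑ k, f k :=
  Equiv.sum_comp (Equiv.addRight 1) f

/-- One averaging step around the cycle preserves the sum weighted by `x⁻¹`. -/
theorem cycle_step_weighted_sum {N : ℕ} {x y z : Fin (N + 1) → ℝ} (hx : ∀ k, 0 < x k)
    (hz : ∀ k, z k = (1 - x k) * y k + x k * y (k + 1)) :
    ∑ k, (x k)⁻¹ * z k = ∑ k, (x k)⁻¹ * y k := by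
  have h : ∀ k, (x k)⁻¹ * z k = (x k)⁻¹ * y k + (y (k + 1) - y k) := fun k => by
    have := (hx k).ne'
    rw [hz]; field_simp; ring
  simp only [h, Finset.sum_add_distrib, Finset.sum_sub_distrib, Fin.sum_comp_add_one y]
  ring

/-- One averaging step around the cycle dissipates the energy weighted by `x⁻¹`. -/
theorem cycle_step_energy {N : ℕ} {x y z : Fin (N + 1) → ℝ} (hx : ∀ k, 0 < x k)
    (hz : ∀ k, z k = (1 - x k) * y k + x k * y (k + 1)) :
    ∑ k, (1 - x k) * (y (k + 1) - y k) ^ 2 =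
      ∑ k, (x k)⁻¹ * y k ^ 2 - ∑ k, (x k)⁻¹ * z k ^ 2 := by
  have h : ∀ k, (1 - x k) * (y (k + 1) - y k) ^ 2 =
      (x k)⁻¹ * y k ^ 2 - (x k)⁻¹ * z k ^ 2 + (y (k + 1) ^ 2 - y k ^ 2) := fun k => by
    have := (hx k).ne'
    rw [hz]; field_simp; ring
  simp only [h, Finset.sum_add_distrib, Finset.sum_sub_distrib,
    Fin.sum_comp_add_one fun k => y k ^ 2]
  ring

open Filter Topology in
/-- Iterated averaging around a cycle with loops converges to the mean weighted by `x⁻¹`. -/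
theorem cycle_iteration_tendsto {N : ℕ} {x : Fin (N + 1) → ℝ} (hx0 : ∀ k, 0 < x k)
    (hx1 : ∀ k, x k < 1) {y : ℕ → Fin (N + 1) → ℝ}
    (hy : ∀ m k, y (m + 1) k = (1 - x k) * y m k + x k * y m (k + 1)) (i : Fin (N + 1)) :
    Tendsto (fun m => y m i) atTop (𝓝 (∑ k, (x k)⁻¹ / (∑ j, (x j)⁻¹) * y 0 k)) := by
  have hw : ∀ k, 0 < (x k)⁻¹ := fun k => inv_pos.2 (hx0 k)
  have hW : 0 < ∑ j, (x j)⁻¹ := Finset.sum_pos (fun k _ => hw k) Finset.univ_nonempty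
  have hstep : ∀ k, Tendsto (fun m => y m (k + 1) - y m k) atTop (𝓝 0) := fun k => by
    have hnonneg : ∀ m j, 0 ≤ (1 - x j) * (y m (j + 1) - y m j) ^ 2 := fun m j =>
      mul_nonneg (sub_nonneg.2 (hx1 j).le) (sq_nonneg _)
    have hlim := tendsto_zero_of_le_decrement (E := fun m => ∑ j, (x j)⁻¹ * y m j ^ 2)
      (fun m => Finset.sum_nonneg fun j _ => mul_nonneg (hw j).le (sq_nonneg _))
      (fun m => hnonneg m k) fun m => by
        rw [← cycle_step_energy hx0 (hy m)]
        exact Finset.single_le_sum (fun j _ => hnonneg m j) (Finset.mem_univ k)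
    have hne : 1 - x k ≠ 0 := (sub_pos.2 (hx1 k)).ne'
    have hsq : Tendsto (fun m => (y m (k + 1) - y m k) ^ 2) atTop (𝓝 0) := by
      simpa [hne] using hlim.const_mul (1 - x k)⁻¹
    rw [tendsto_zero_iff_abs_tendsto_zero]
    simpa [Function.comp_def, Real.sqrt_sq_eq_abs] using
      (Real.continuous_sqrt.tendsto 0).comp hsq
  have hzero : ∀ k, Tendsto (fun m => y m k - y m 0) atTop (𝓝 0) := fun k => by
    induction k using Fin.induction with
    | zero => simp
    | succ k ih => simpa [Fin.coeSucc_eq_succ] using (hstep k.castSucc).add ih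
  have hmean : ∀ m, ∑ k, (x k)⁻¹ * y m k = ∑ k, (x k)⁻¹ * y 0 k := fun m => by
    induction m with
    | zero => rfl
    | succ m ih => rw [cycle_step_weighted_sum hx0 (hy m), ih]
  have hdev : ∀ m, y m i = ∑ k, (x k)⁻¹ / (∑ j, (x j)⁻¹) * y 0 k +
      ∑ k, (x k)⁻¹ / (∑ j, (x j)⁻¹) * ((y m i - y m 0) - (y m k - y m 0)) := fun m => by
    have hsum : ∑ k, (x k)⁻¹ / (∑ j, (x j)⁻¹) * ((y m i - y m 0) - (y m k - y m 0)) =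
        (∑ k, (x k)⁻¹) / (∑ j, (x j)⁻¹) * y m i - (∑ k, (x k)⁻¹ * y m k) / ∑ j, (x j)⁻¹ := by
      rw [Finset.sum_div, Finset.sum_div, Finset.sum_mul, ← Finset.sum_sub_distrib]
      exact Finset.sum_congr rfl fun k _ => by ring
    rw [hsum, hmean m, div_self hW.ne', Finset.sum_div]
    simp only [div_mul_eq_mul_div]
    ring
  have hlim : Tendsto (fun m => ∑ k, (x k)⁻¹ / (∑ j, (x j)⁻¹) *
      ((y m i - y m 0) - (y m k - y m 0))) atTop (𝓝 0) := by
    simpa using tendsto_finsetSum Finset.univ fun k _ =>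
      ((hzero i).sub (hzero k)).const_mul ((x k)⁻¹ / ∑ j, (x j)⁻¹)
  rw [funext hdev]
  simpa only [add_zero] using hlim.const_add (∑ k, (x k)⁻¹ / (∑ j, (x j)⁻¹) * y 0 k)

/-- With `P` and `π` as in Statement 5, for every initial opinion vector
`s : Fin n → ℝ` every coordinate of `P^m s` tends to the consensus `∑ k, π k * s k`. -/
theorem cycle_with_loops_consensus (n : ℕ) (hn : 2 ≤ n)
    (x : Fin n → ℝ) (hx0 : ∀ k, 0 < x k) (hx1 : ∀ k, x k < 1)
    (P : Matrix (Fin n) (Fin n) ℝ)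
    (hP : ∀ k j, P k j = if (j : ℕ) = ((k : ℕ) + 1) % n then x k else if j = k then 1 - x k else 0)
    (π : Fin n → ℝ) (hπ : ∀ k, π k = (x k)⁻¹ / ∑ j, (x j)⁻¹) :
    ∀ s : Fin n → ℝ, ∀ i, Filter.Tendsto (fun m : ℕ => ((P ^ m).mulVec s) i)
      Filter.atTop (nhds (∑ k, π k * s k)) := by
  obtain ⟨N, rfl⟩ := Nat.exists_eq_add_of_le' hn
  intro s i
  have hentry : ∀ k j, P k j =
      (if j = k then 1 - x k else 0) + if j = k + 1 then x k else 0 := fun k j => by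
    have hiff : (j : ℕ) = ((k : ℕ) + 1) % (N + 2) ↔ j = k + 1 := by
      rw [Fin.ext_iff, Fin.val_add, Fin.val_one]
    rw [hP]
    simp only [hiff]
    by_cases h : j = k + 1 <;> simp [h]
  have hstep : ∀ (y : Fin (N + 2) → ℝ) k,
      P.mulVec y k = (1 - x k) * y k + x k * y (k + 1) := fun y k => by
    simp [Matrix.mulVec, dotProduct, hentry, add_mul, Finset.sum_add_distrib]
  simpa [hπ] using cycle_iteration_tendsto hx0 hx1 (y := fun m => (P ^ m).mulVec s)
    (fun m k => by rw [pow_succ', ← Matrix.mulVec_mulVec, hstep]) i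
end

section
/- Let n ≥ 2, let π : Fin n → ℝ be a positive probability vector (π_k > 0 for all k, ∑_k π_k = 1), and let β be a real number with 0 < β < min_k π_k. Define the n × n real matrix P by P_{k, k+1} = β/π_k (indices mod n), P_{k,k} = 1 − β/π_k, and all other entries 0. Then P is row-stochastic and lim_{m→∞} P^m = 𝟙πᵀ (entrywise), so that for every initial opinion vector s ∈ ℝ^n, DeGroot's method with influence matrix P reaches the consensus πᵀs: lim_{m→∞} P^m s = (∑_k π_k s_k)·𝟙. (This is Proposition 1 of the paper: every positive probability weight vector π is implemented as the final weight distribution of a DeGroot procedure whose communication digraph is a Hamiltonian cycle with loops, the weight of the arc entering vertex k being proportional to π_k^{-1}.) -/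
open Filter Topology Matrix

section Stochastic

variable {ι : Type*} [Fintype ι]

/-- A nonnegative matrix with constant row sums `c` scales sup-norm bounds by `c`. -/
lemma abs_mulVec_le_of_row_sum {A : Matrix ι ι ℝ} {c B : ℝ} {v : ι → ℝ}
    (hA : ∀ i j, 0 ≤ A i j) (hsum : ∀ i, ∑ j, A i j = c) (hv : ∀ j, |v j| ≤ B) (i : ι) :
    |(A *ᵥ v) i| ≤ c * B := by
  calc |∑ j, A i j * v j| ≤ ∑ j, |A i j * v j| := Finset.abs_sum_le_sum_abs _ _
    _ ≤ ∑ j, A i j * B := by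
        refine Finset.sum_le_sum fun j _ => ?_
        rw [abs_mul, abs_of_nonneg (hA i j)]
        exact mul_le_mul_of_nonneg_left (hv j) (hA i j)
    _ = c * B := by rw [← Finset.sum_mul, hsum]

/-- Doeblin's contraction: if `A i j ≥ δ π_j`, then `A` contracts the vectors orthogonal to `π`
by the factor `1 - δ` in the sup norm. -/
lemma abs_mulVec_le_of_minorization {A : Matrix ι ι ℝ} {π v : ι → ℝ} {δ B : ℝ}
    (hA : ∀ i, ∑ j, A i j = 1) (hπ : ∑ j, π j = 1) (hδ : ∀ i j, δ * π j ≤ A i j)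
    (hv : π ⬝ᵥ v = 0) (hB : ∀ j, |v j| ≤ B) (i : ι) :
    |(A *ᵥ v) i| ≤ (1 - δ) * B := by
  have h := abs_mulVec_le_of_row_sum (A := Matrix.of fun i j => A i j - δ * π j) (c := 1 - δ)
    (fun i j => sub_nonneg.2 (hδ i j))
    (fun i => by simp [Finset.sum_sub_distrib, ← Finset.mul_sum, hA, hπ]) hB i
  have e : ((Matrix.of fun i j => A i j - δ * π j) *ᵥ v) i = (A *ᵥ v) i := by
    simp only [mulVec, dotProduct, of_apply, sub_mul, Finset.sum_sub_distrib, mul_assoc,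
      ← Finset.mul_sum] at hv ⊢
    rw [hv, mul_zero, sub_zero]
  rwa [e] at h

variable [DecidableEq ι]

/-- If some power of a row-stochastic matrix `P` with stationary probability vector `π` is
entrywise positive, then `P ^ m *ᵥ s` converges to the constant vector `π ⬝ᵥ s`. -/
lemma tendsto_pow_mulVec_of_pow_pos {P : Matrix ι ι ℝ} {π : ι → ℝ}
    (hP : P ∈ rowStochastic ℝ ι) (hπ0 : ∀ j, 0 ≤ π j) (hπ : ∑ j, π j = 1) (hstat : π ᵥ* P = π)
    {N : ℕ} (hN : N ≠ 0) (hpos : ∀ i j, 0 < (P ^ N) i j) (s : ι → ℝ) (i : ι) :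
    Tendsto (fun m : ℕ => (P ^ m *ᵥ s) i) atTop (𝓝 (π ⬝ᵥ s)) := by
  have : Nonempty ι := ⟨i⟩
  have hpow (m : ℕ) : P ^ m ∈ rowStochastic ℝ ι := pow_mem hP m
  have hstat' (m : ℕ) : π ᵥ* P ^ m = π := by
    induction m with
    | zero => simp
    | succ m ih => rw [pow_succ, ← vecMul_vecMul, ih, hstat]
  obtain ⟨p, hp⟩ := Finite.exists_min fun p : ι × ι => (P ^ N) p.1 p.2
  set δ := (P ^ N) p.1 p.2
  have hδ0 : 0 < δ := hpos _ _
  have hδ1 : δ ≤ 1 := le_one_of_mem_rowStochastic (hpow N)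
  have hminor (i j : ι) : δ * π j ≤ (P ^ N) i j := by
    have h1 : π j ≤ 1 := hπ ▸ Finset.single_le_sum (fun k _ => hπ0 k) (Finset.mem_univ j)
    exact (mul_le_of_le_one_right hδ0.le h1).trans (hp (i, j))
  set v : ι → ℝ := fun j => s j - π ⬝ᵥ s with hvdef
  have hv : π ⬝ᵥ v = 0 := by
    simp only [hvdef, dotProduct, mul_sub, Finset.sum_sub_distrib, ← Finset.sum_mul, hπ, one_mul,
      sub_self]
  have hv' (m : ℕ) : π ⬝ᵥ (P ^ m *ᵥ v) = 0 := by rw [dotProduct_mulVec, hstat', hv]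
  have hblock (q : ℕ) : ∀ j, |(P ^ (N * q) *ᵥ v) j| ≤ (1 - δ) ^ q * ‖v‖ := by
    induction q with
    | zero => simpa using norm_le_pi_norm v
    | succ q ih =>
      intro j
      rw [mul_add_one, add_comm, pow_add, ← mulVec_mulVec, pow_succ', mul_assoc]
      exact abs_mulVec_le_of_minorization (sum_row_of_mem_rowStochastic (hpow N)) hπ hminor
        (hv' _) ih j
  have hbound (m : ℕ) : |(P ^ m *ᵥ v) i| ≤ (1 - δ) ^ (m / N) * ‖v‖ := by
    have h := abs_mulVec_le_of_row_sum (A := P ^ (m % N))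
      (fun _ _ => nonneg_of_mem_rowStochastic (hpow (m % N)))
      (sum_row_of_mem_rowStochastic (hpow (m % N))) (hblock (m / N)) i
    rwa [mulVec_mulVec, ← pow_add, Nat.mod_add_div, one_mul] at h
  have hzero : Tendsto (fun m : ℕ => (P ^ m *ᵥ v) i) atTop (𝓝 0) := by
    refine squeeze_zero_norm hbound ?_
    have h := (tendsto_pow_atTop_nhds_zero_of_lt_one (sub_nonneg.2 hδ1)
      (sub_lt_self 1 hδ0)).comp (Nat.tendsto_div_const_atTop hN)
    simpa using h.mul_const ‖v‖
  have hsplit (m : ℕ) : (P ^ m *ᵥ s) i = (P ^ m *ᵥ v) i + π ⬝ᵥ s := by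
    simp only [hvdef, mulVec, dotProduct, mul_sub, Finset.sum_sub_distrib, ← Finset.sum_mul,
      sum_row_of_mem_rowStochastic (hpow m), one_mul, sub_add_cancel]
  simpa [hsplit] using hzero.add_const (π ⬝ᵥ s)

end Stochastic

/-- If a nonnegative matrix has positive diagonal and positive entries at all `(k, k + 1)`
(indices mod `n`), then `A ^ m` is positive at `(i, i + d)` for all `d ≤ m`. -/
lemma pow_pos_of_cycle_with_loops {n : ℕ} {A : Matrix (Fin n) (Fin n) ℝ}
    (hA : ∀ i j, 0 ≤ A i j) (hdiag : ∀ i, 0 < A i i)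
    (hcycle : ∀ i j : Fin n, (j : ℕ) = (i + 1) % n → 0 < A i j) (m : ℕ) :
    ∀ d ≤ m, ∀ i j : Fin n, (j : ℕ) = (i + d) % n → 0 < (A ^ m) i j := by
  have hnonneg (m : ℕ) : ∀ i j, 0 ≤ (A ^ m) i j := by
    induction m with
    | zero => intro i j; rw [pow_zero, one_apply]; positivity
    | succ m ih =>
      intro i j
      rw [pow_succ', mul_apply]
      exact Finset.sum_nonneg fun k _ => mul_nonneg (hA i k) (ih k j)
  induction m with
  | zero =>
    intro d hd i j hj
    have hij : i = j := by
      obtain rfl : d = 0 := by omega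
      rw [add_zero, Nat.mod_eq_of_lt i.isLt] at hj
      exact Fin.ext hj.symm
    simp [hij]
  | succ m ih =>
    intro d hd i j hj
    obtain ⟨k, hik, hkj⟩ : ∃ k, 0 < A i k ∧ 0 < (A ^ m) k j := by
      cases d with
      | zero => exact ⟨i, hdiag i, ih 0 (Nat.zero_le m) i j hj⟩
      | succ d =>
        refine ⟨⟨(i + 1) % n, Nat.mod_lt _ i.pos⟩, hcycle _ _ rfl, ih d (by omega) _ _ ?_⟩
        rw [hj, Nat.mod_add_mod]
        congr 1
        ring
    rw [pow_succ', mul_apply]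
    exact Finset.sum_pos' (fun k _ => mul_nonneg (hA i k) (hnonneg m k j))
      ⟨k, Finset.mem_univ k, mul_pos hik hkj⟩


/-- Proposition 1 of the paper: Let `π` be a positive probability vector on
`Fin n` (`n ≥ 2`) and `0 < β < min_k π_k`. The matrix `P` of the Hamiltonian cycle with
loops with `P k (k+1) = β/π_k`, `P k k = 1 - β/π_k`, other entries `0`, is row-stochastic,
`P^m → 𝟙πᵀ` entrywise, and DeGroot's method reaches the consensus `πᵀs` for every `s`. -/
theorem cycle_with_loops_implements_pi (n : ℕ) (hn : 2 ≤ n)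
    (π : Fin n → ℝ) (hπpos : ∀ k, 0 < π k) (hπsum : ∑ k, π k = 1)
    (β : ℝ) (hβpos : 0 < β) (hβlt : ∀ k, β < π k)
    (P : Matrix (Fin n) (Fin n) ℝ)
    (hP : ∀ k j, P k j =
      if (j : ℕ) = ((k : ℕ) + 1) % n then β / π k else if j = k then 1 - β / π k else 0) :
    (∀ i j, 0 ≤ P i j) ∧ (∀ i, ∑ j, P i j = 1) ∧
    (∀ i j, Filter.Tendsto (fun m : ℕ => (P ^ m) i j) Filter.atTop (nhds (π j))) ∧
    (∀ s : Fin n → ℝ, ∀ i, Filter.Tendsto (fun m : ℕ => ((P ^ m).mulVec s) i)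
      Filter.atTop (nhds (∑ k, π k * s k))) := by
  have : NeZero n := ⟨by omega⟩
  have hsucc (k j : Fin n) : (j : ℕ) = ((k : ℕ) + 1) % n ↔ j = k + 1 := by
    rw [Fin.ext_iff, Fin.val_add, Fin.val_one', Nat.add_mod_mod]
  have hne (k : Fin n) : k ≠ k + 1 := by
    rw [Ne, left_eq_add, Fin.ext_iff, Fin.val_one', Nat.mod_eq_of_lt hn]
    simp
  have hsplit (k j : Fin n) : P k j =
      (if j = k + 1 then β / π k else 0) + (if j = k then 1 - β / π k else 0) := by
    rw [hP]
    simp only [hsucc]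
    by_cases h : j = k + 1
    · subst h
      simp [(hne k).symm]
    · simp [h]
  have harc (k : Fin n) : 0 < β / π k := div_pos hβpos (hπpos k)
  have hloop (k : Fin n) : 0 < 1 - β / π k := sub_pos.2 ((div_lt_one (hπpos k)).2 (hβlt k))
  have hnonneg (i j : Fin n) : 0 ≤ P i j := by
    rw [hP]
    split_ifs
    exacts [(harc i).le, (hloop i).le, le_rfl]
  have hsum (i : Fin n) : ∑ j, P i j = 1 := by
    simp [hsplit, Finset.sum_add_distrib]
  have hstat : π ᵥ* P = π := by
    ext j
    have hpred (k : Fin n) : j = k + 1 ↔ k = j - 1 := by rw [eq_sub_iff_add_eq, eq_comm]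
    simp only [vecMul, dotProduct, hsplit, mul_add, Finset.sum_add_distrib, hpred, mul_ite,
      mul_zero, Finset.sum_ite_eq, Finset.sum_ite_eq', Finset.mem_univ, if_true]
    have := (hπpos j).ne'
    have := (hπpos (j - 1)).ne'
    field_simp
    ring
  have hpos (i j : Fin n) : 0 < (P ^ n) i j := by
    refine pow_pos_of_cycle_with_loops hnonneg (fun k => ?_) (fun k l h => ?_) n
      ((j + (n - i)) % n) (Nat.mod_lt _ i.pos).le i j ?_
    · simpa [hsplit, hne] using hloop k
    · simpa [hP, h] using harc k
    · rw [Nat.add_mod_mod, show (i : ℕ) + (j + (n - i)) = j + n by omega, Nat.add_mod_right,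
        Nat.mod_eq_of_lt j.isLt]
  have hlim (s : Fin n → ℝ) (i : Fin n) :=
    tendsto_pow_mulVec_of_pow_pos (mem_rowStochastic_iff_sum.2 ⟨hnonneg, hsum⟩)
      (fun k => (hπpos k).le) hπsum hstat (NeZero.ne n) hpos s i
  refine ⟨hnonneg, hsum, fun i j => ?_, hlim⟩
  simpa using hlim (Pi.single j 1) i
end

section
/- Let n ≥ 2, let σ be a permutation of Fin n that is a single n-cycle (i.e., σ generates a transitive cyclic group on Fin n), and let x : Fin n → ℝ satisfy 0 < x_k < 1 for every k. Define the n × n real matrix P by P_{k, σ(k)} = x_k, P_{k,k} = 1 − x_k, and all other entries 0, and define π_k = x_k^{-1} / (∑_j x_j^{-1}). Then lim_{m→∞} P^m = 𝟙πᵀ (entrywise). -/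
namespace Matrix

variable {ι : Type*} [Fintype ι] [DecidableEq ι]

/-- Doeblin's estimate: a row-stochastic matrix that dominates `δ 𝟙pᵀ` contracts the sup norm on
the kernel of `p` by the factor `1 - δ`. -/
theorem norm_mulVec_le_of_doeblin {Q : Matrix ι ι ℝ} (hQ : Q ∈ rowStochastic ℝ ι) {p : ι → ℝ}
    (hp : ∑ j, p j = 1) {δ : ℝ} (hδ : δ ≤ 1) (h : ∀ i j, δ * p j ≤ Q i j) {u : ι → ℝ}
    (hu : p ⬝ᵥ u = 0) : ‖Q *ᵥ u‖ ≤ (1 - δ) * ‖u‖ := by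
  refine (pi_norm_le_iff_of_nonneg (mul_nonneg (sub_nonneg.2 hδ) (norm_nonneg u))).2 fun i ↦ ?_
  have hrow : (Q *ᵥ u) i = ∑ j, (Q i j - δ * p j) * u j := by
    have : ∑ j, δ * p j * u j = 0 := by
      simpa [dotProduct, Finset.mul_sum, mul_assoc] using congrArg (δ * ·) hu
    simp [mulVec, dotProduct, sub_mul, this]
  calc ‖(Q *ᵥ u) i‖ ≤ ∑ j, ‖(Q i j - δ * p j) * u j‖ := hrow ▸ norm_sum_le _ _
    _ ≤ ∑ j, (Q i j - δ * p j) * ‖u‖ := Finset.sum_le_sum fun j _ ↦ by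
        rw [norm_mul, Real.norm_of_nonneg (sub_nonneg.2 (h i j))]
        exact mul_le_mul_of_nonneg_left (norm_le_pi_norm u j) (sub_nonneg.2 (h i j))
    _ = (1 - δ) * ‖u‖ := by
        rw [← Finset.sum_mul, Finset.sum_sub_distrib, ← Finset.mul_sum, hp,
          sum_row_of_mem_rowStochastic hQ, mul_one]

/-- The entries of the powers of a primitive row-stochastic matrix converge to those of `𝟙pᵀ`,
where `p` is a stationary probability vector. -/
theorem IsPrimitive.tendsto_pow_apply {P : Matrix ι ι ℝ} (hprim : P.IsPrimitive)
    (hP : P ∈ rowStochastic ℝ ι) {p : ι → ℝ} (hp0 : ∀ j, 0 ≤ p j) (hp1 : ∑ j, p j = 1)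
    (hpP : p ᵥ* P = p) (i j : ι) :
    Filter.Tendsto (fun m : ℕ ↦ (P ^ m) i j) Filter.atTop (nhds (p j)) := by
  obtain ⟨N, -, hN⟩ := hprim.exists_pos_pow
  have hpm (m : ℕ) : p ᵥ* P ^ m = p := by
    induction m with
    | zero => simp
    | succ m ih => rw [pow_succ, ← vecMul_vecMul, ih, hpP]
  have : Nonempty (ι × ι) := ⟨(i, j)⟩
  obtain ⟨ab, hab⟩ := Finite.exists_min fun ab : ι × ι ↦ (P ^ N) ab.1 ab.2
  set δ := (P ^ N) ab.1 ab.2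
  have hδ0 : 0 < δ := hN _ _
  have hδ1 : δ ≤ 1 := le_one_of_mem_rowStochastic (pow_mem hP N)
  have hle (a b : ι) : δ * p b ≤ (P ^ N) a b := by
    have hpb : p b ≤ 1 := hp1 ▸ Finset.single_le_sum (fun k _ ↦ hp0 k) (Finset.mem_univ b)
    exact (mul_le_of_le_one_right hδ0.le hpb).trans (hab (a, b))
  let u : ι → ℝ := Pi.single j 1 - fun _ ↦ p j
  have hu (m : ℕ) : p ⬝ᵥ (P ^ m *ᵥ u) = 0 := by
    rw [dotProduct_mulVec, hpm]
    simp [u, dotProduct, mul_sub, ← Finset.sum_mul, hp1, Pi.single_apply]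
  have hentry (m : ℕ) : (P ^ m) i j = p j + (P ^ m *ᵥ u) i := by
    simp [u, mulVec, dotProduct, mul_sub, ← Finset.sum_mul, Pi.single_apply,
      sum_row_of_mem_rowStochastic (pow_mem hP m)]
  have hanti : Antitone fun m : ℕ ↦ ‖P ^ m *ᵥ u‖ := antitone_nat_of_succ_le fun m ↦ by
    have := norm_mulVec_le_of_doeblin hP hp1 zero_le_one
      (fun a b ↦ by simpa using hP.1 a b) (hu m)
    simpa [pow_succ', mulVec_mulVec] using this
  have hcontr (m : ℕ) : ‖P ^ (m + N) *ᵥ u‖ ≤ (1 - δ) * ‖P ^ m *ᵥ u‖ := by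
    have := norm_mulVec_le_of_doeblin (pow_mem hP N) hp1 hδ1 hle (hu m)
    rwa [mulVec_mulVec, ← pow_add, add_comm N] at this
  have hlim := tendsto_atTop_ciInf hanti ⟨0, by rintro _ ⟨m, rfl⟩; exact norm_nonneg _⟩
  set L := ⨅ m : ℕ, ‖P ^ m *ᵥ u‖
  have hL0 : 0 ≤ L := ge_of_tendsto' hlim fun m ↦ norm_nonneg _
  have hL1 : L ≤ (1 - δ) * L := le_of_tendsto_of_tendsto'
    (hlim.comp (Filter.tendsto_add_atTop_nat N)) (hlim.const_mul _) hcontr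
  have hL : L = 0 := by nlinarith
  rw [hL] at hlim
  have hcoord := tendsto_pi_nhds.1 (tendsto_zero_iff_norm_tendsto_zero.2 hlim) i
  simpa [hentry] using hcoord.const_add (p j)

/-- A nonnegative matrix with positive diagonal that is positive along a permutation `σ` has
positive `(i, σ^s i)` entries in its `m`-th power for `s ≤ m`. -/
theorem pow_apply_perm_pow_pos {P : Matrix ι ι ℝ} (h0 : ∀ i j, 0 ≤ P i j)
    (hdiag : ∀ i, 0 < P i i) {σ : Equiv.Perm ι} (hσ : ∀ i, 0 < P i (σ i)) {m s : ℕ} (hs : s ≤ m)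
    (i : ι) : 0 < (P ^ m) i ((σ ^ s) i) := by
  have hm (m : ℕ) (a b : ι) : 0 ≤ (P ^ m) a b := by
    induction m generalizing a b with
    | zero => rw [pow_zero, one_apply]; split_ifs <;> norm_num
    | succ m ih =>
      rw [pow_succ, mul_apply]
      exact Finset.sum_nonneg fun k _ ↦ mul_nonneg (ih a k) (h0 k b)
  induction m generalizing s i with
  | zero =>
    obtain rfl : s = 0 := by omega
    simp
  | succ m ih =>
    rw [pow_succ', mul_apply]
    refine Finset.sum_pos' (fun k _ ↦ mul_nonneg (h0 i k) (hm m k _)) ?_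
    cases s with
    | zero => exact ⟨i, Finset.mem_univ _, mul_pos (hdiag i) (ih (Nat.zero_le m) i)⟩
    | succ s =>
      refine ⟨σ i, Finset.mem_univ _, mul_pos (hσ i) ?_⟩
      rw [pow_succ, Equiv.Perm.mul_apply]
      exact ih (by omega) (σ i)

end Matrix

/-- Let `σ` be an `n`-cycle on `Fin n` (`n ≥ 2`) and `0 < x_k < 1` for all `k`.
The matrix `P` with `P k (σ k) = x_k`, `P k k = 1 - x_k`, other entries `0`, satisfies
`P^m → 𝟙πᵀ` entrywise, where `π_k = x_k⁻¹ / ∑_j x_j⁻¹`: the order of visiting the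
vertices in the Hamiltonian cycle is arbitrary. -/
theorem arbitrary_cycle_order_same_limit (n : ℕ) (hn : 2 ≤ n)
    (σ : Equiv.Perm (Fin n)) (hσ : σ.IsCycle) (hσsupp : σ.support = Finset.univ)
    (x : Fin n → ℝ) (hx0 : ∀ k, 0 < x k) (hx1 : ∀ k, x k < 1)
    (P : Matrix (Fin n) (Fin n) ℝ)
    (hP : ∀ k j, P k j = if j = σ k then x k else if j = k then 1 - x k else 0)
    (π : Fin n → ℝ) (hπ : ∀ k, π k = (x k)⁻¹ / ∑ j, (x j)⁻¹) :
    ∀ i j, Filter.Tendsto (fun m : ℕ => (P ^ m) i j) Filter.atTop (nhds (π j)) := by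
  have hσne (k : Fin n) : σ k ≠ k := by
    rw [← Equiv.Perm.mem_support, hσsupp]; exact Finset.mem_univ k
  have hσinv (k : Fin n) : σ.symm k ≠ k := fun h ↦ hσne k (σ.symm_apply_eq.1 h).symm
  have hPdiag (k : Fin n) : P k k = 1 - x k := by simp [hP, (hσne k).symm]
  have hPσ (k : Fin n) : P k (σ k) = x k := by simp [hP]
  have hP0 (k j : Fin n) : 0 ≤ P k j := by
    rw [hP]; split_ifs <;> linarith [hx0 k, hx1 k]
  have hstoch : P ∈ Matrix.rowStochastic ℝ (Fin n) := by
    refine Matrix.mem_rowStochastic_iff_sum.2 ⟨hP0, fun k ↦ ?_⟩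
    rw [Fintype.sum_eq_add (σ k) k (hσne k) fun j hj ↦ by simp [hP, hj.1, hj.2], hPdiag, hPσ]
    ring
  have hprim : P.IsPrimitive := by
    refine ⟨hP0, orderOf σ, orderOf_pos σ, fun i j ↦ ?_⟩
    obtain ⟨s, hs, rfl⟩ := (hσ.sameCycle (hσne i) (hσne j)).exists_pow_eq'
    exact Matrix.pow_apply_perm_pow_pos hP0 (fun k ↦ by linarith [hPdiag k, hx1 k])
      (fun k ↦ by linarith [hPσ k, hx0 k]) hs.le i
  have hsum : 0 < ∑ j, (x j)⁻¹ :=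
    Finset.sum_pos (fun j _ ↦ inv_pos.2 (hx0 j)) ⟨⟨0, by omega⟩, Finset.mem_univ _⟩
  have hπx (k : Fin n) : π k * x k = (∑ j, (x j)⁻¹)⁻¹ := by
    have := (hx0 k).ne'
    rw [hπ]; field_simp
  refine hprim.tendsto_pow_apply hstoch (fun k ↦ ?_) ?_ ?_
  · rw [hπ]; exact div_nonneg (inv_pos.2 (hx0 k)).le hsum.le
  · simp only [hπ, ← Finset.sum_div, div_self hsum.ne']
  · ext j
    have hother (k : Fin n) (hk : k ≠ σ.symm j ∧ k ≠ j) : π k * P k j = 0 := by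
      have : j ≠ σ k := fun h ↦ hk.1 (by rw [h, σ.symm_apply_apply])
      simp [hP, this, hk.2.symm]
    have hpred : P (σ.symm j) j = x (σ.symm j) := by simpa using hPσ (σ.symm j)
    rw [Matrix.vecMul, dotProduct, Fintype.sum_eq_add _ j (hσinv j) hother, hpred, hPdiag, hπx]
    linarith [hπx j]
end
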